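/- For every unit vector ψ indexed by Fin m × Fin n, the von Neumann entropy of either reduced density matrix is bounded by the logarithm of the smaller dimension: S(Tr₂ P_ψ) ≤ log (min m n). -/

import Mathlib

open scoped Classical

/-- The rank-one density matrix `P_ψ` of a vector `ψ`, with entries
`P_ψ(x,y) = ψ(x) ⬝ conj (ψ(y))`. -/
noncomputable def densityMatrix {ι : Type*} (ψ : ι → ℂ) : Matrix ι ι ℂ :=
  fun x y => ψ x * star (ψ y)

/-- Partial trace over the second tensor factor. -/
noncomputable def ptrace2 {m n : ℕ} (M : Matrix (Fin m × Fin n) (Fin m × Fin n) ℂ) :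
    Matrix (Fin m) (Fin m) ℂ :=
  fun i i' => ∑ j, M (i, j) (i', j)

/-- The von Neumann entropy `S(ρ) = -∑ᵢ λᵢ log λᵢ` of a (Hermitian) matrix. -/
noncomputable def vonNeumannEntropy {d : Type*} [Fintype d] [DecidableEq d]
    (ρ : Matrix d d ℂ) : ℝ :=
  if h : ρ.IsHermitian then -∑ i, h.eigenvalues i * Real.log (h.eigenvalues i) else 0

open scoped ComplexOrder

/-- The Shannon entropy of a probability vector with at most `r` nonzero entries is at most
`log r`. -/
theorem neg_sum_mul_log_le_log_of_card_support_le {ι : Type*} [Fintype ι] {p : ι → ℝ}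
    (hp : ∀ i, 0 ≤ p i) (hsum : ∑ i, p i = 1) {r : ℕ}
    (hr : Fintype.card {i // p i ≠ 0} ≤ r) :
    -∑ i, p i * Real.log (p i) ≤ Real.log r := by
  have hcard : 0 < r := by
    refine lt_of_lt_of_le (Fintype.card_pos_iff.2 ?_) hr
    by_contra h
    rw [not_nonempty_iff] at h
    have hzero : ∀ i, p i = 0 := fun i => by_contra fun hi => h.false ⟨i, hi⟩
    simp [hzero] at hsum
  have hr0 : (0 : ℝ) < r := by exact_mod_cast hcard
  have key : ∀ i, -(p i * Real.log (p i)) - p i * Real.log r ≤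
      (if p i ≠ 0 then (1 : ℝ) / r else 0) - p i := by
    intro i
    rcases (hp i).eq_or_lt with h | h
    · simp [← h]
    · have hlog := Real.log_le_sub_one_of_pos (inv_pos.2 (mul_pos hr0 h))
      rw [Real.log_inv, Real.log_mul hr0.ne' h.ne'] at hlog
      have hmul := mul_le_mul_of_nonneg_left hlog h.le
      have heq : p i * ((r * p i)⁻¹ - 1) = 1 / r - p i := by
        field_simp
      rw [heq] at hmul
      rw [if_pos h.ne']
      linarith
  have hle := Finset.sum_le_sum fun i (_ : i ∈ Finset.univ) => key i
  rw [Finset.sum_sub_distrib, Finset.sum_sub_distrib, ← Finset.sum_mul, hsum,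
    Finset.sum_neg_distrib, ← Finset.sum_filter, Finset.sum_const, nsmul_eq_mul,
    ← Fintype.card_subtype] at hle
  have hone : (Fintype.card {i // p i ≠ 0} : ℝ) * (1 / r) ≤ 1 := by
    rw [mul_one_div, div_le_one hr0]
    exact_mod_cast hr
  linarith

/-- A density matrix of rank at most `r` has von Neumann entropy at most `log r`. -/
theorem vonNeumannEntropy_le_log_of_rank_le {d : Type*} [Fintype d] [DecidableEq d]
    {ρ : Matrix d d ℂ} (hρ : ρ.PosSemidef) (htr : ρ.trace = 1) {r : ℕ} (hr : ρ.rank ≤ r) :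
    vonNeumannEntropy ρ ≤ Real.log r := by
  rw [vonNeumannEntropy, dif_pos hρ.isHermitian]
  refine neg_sum_mul_log_le_log_of_card_support_le hρ.eigenvalues_nonneg ?_ ?_
  · simpa [hρ.isHermitian.trace_eq_sum_eigenvalues] using congrArg Complex.re htr
  · rw [hρ.isHermitian.rank_eq_card_non_zero_eigs] at hr
    convert hr

/-- The reduced density matrix of `ψ` is `A * Aᴴ`, where `A` is the coefficient matrix of `ψ`. -/
theorem ptrace2_densityMatrix {m n : ℕ} (ψ : Fin m × Fin n → ℂ) :
    ptrace2 (densityMatrix ψ) =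
      Matrix.of (Function.curry ψ) * (Matrix.of (Function.curry ψ)).conjTranspose := by
  ext i i'
  simp [ptrace2, densityMatrix, Matrix.mul_apply, Function.curry]

theorem trace_ptrace2_densityMatrix {m n : ℕ} (ψ : Fin m × Fin n → ℂ) :
    (ptrace2 (densityMatrix ψ)).trace = ((∑ x, ‖ψ x‖ ^ 2 : ℝ) : ℂ) := by
  simp [Matrix.trace, ptrace2, densityMatrix, Fintype.sum_prod_type, Complex.mul_conj']

/-- For every unit vector `ψ` on a bipartite system, the von Neumann entropy of
either reduced density matrix is bounded by the logarithm of the smaller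
dimension: `S(Tr₂ P_ψ) ≤ log (min m n)`. -/
theorem entropy_le_log_min_dim (m n : ℕ) (ψ : Fin m × Fin n → ℂ)
    (hψ : ∑ x, ‖ψ x‖ ^ 2 = 1) :
    vonNeumannEntropy (ptrace2 (densityMatrix ψ)) ≤ Real.log (min (m : ℝ) (n : ℝ)) := by
  have hA := ptrace2_densityMatrix ψ
  rw [← Nat.cast_min]
  refine vonNeumannEntropy_le_log_of_rank_le ?_ ?_ (le_min ?_ ?_)
  · rw [hA]
    exact Matrix.posSemidef_self_mul_conjTranspose _
  · rw [trace_ptrace2_densityMatrix, hψ, Complex.ofReal_one]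
  · exact Matrix.rank_le_height _
  · rw [hA]
    exact (Matrix.rank_mul_le_left _ _).trans (Matrix.rank_le_width _)
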